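/- arXiv:2506.03947 — 6 statements merged into one kernel-verified Lean document; each statement's English description precedes it below -/
import Mathlib

section
/- Let A be an N×N real symmetric positive definite matrix and let ℓ ≥ 2 be an integer. Let 𝒜 = I_ℓ ⊗ A + S ⊗ (−I_N) be the ℓN×ℓN block lower bidiagonal matrix with diagonal blocks A and subdiagonal blocks −I_N, where S is the ℓ×ℓ matrix with ones on the subdiagonal and zeros elsewhere. Then 𝒜 is invertible and, with E_i = e_i ⊗ I_N (e_i the i-th standard basis column of ℝ^ℓ), the bottom-left N×N block of 𝒜^{−1} satisfies E_ℓ^T 𝒜^{−1} E_1 = A^{−ℓ}. -/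
open Matrix Kronecker

/-- A block column `(G 0, …, G (ℓ - 1))` is multiplied by the block lower bidiagonal matrix
`I_ℓ ⊗ A + S ⊗ (-I)` via the recursion `A * G i - G (i - 1)`. -/
lemma blockBidiagonal_mul_apply {n m R : Type*} [Fintype n] [DecidableEq n] [CommRing R] {ℓ : ℕ}
    (A : Matrix n n R) (G : ℕ → Matrix n m R) (i : Fin ℓ) (a : n) (b : m) :
    ∑ p : Fin ℓ × n, ((1 : Matrix (Fin ℓ) (Fin ℓ) R) ⊗ₖ A +
        (Matrix.of fun i j : Fin ℓ => if (i : ℕ) = (j : ℕ) + 1 then (1 : R) else 0) ⊗ₖ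
          (-(1 : Matrix n n R))) (i, a) p * G p.1 p.2 b =
      (A * G i - if (i : ℕ) = 0 then 0 else G (i - 1)) a b := by
  have hdiag : ∑ k : Fin ℓ, ∑ c : n, (1 : Matrix (Fin ℓ) (Fin ℓ) R) i k * A a c * G k c b =
      (A * G i) a b := by
    rw [Finset.sum_eq_single i (fun k _ hk => by simp [Matrix.one_apply_ne hk.symm]) (by simp)]
    simp [Matrix.mul_apply]
  have hsub : ∑ k : Fin ℓ, ∑ c : n,
      (if (i : ℕ) = (k : ℕ) + 1 then (1 : R) else 0) * (1 : Matrix n n R) a c * G k c b =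
      (if (i : ℕ) = 0 then 0 else G (i - 1)) a b := by
    have hcol (k : Fin ℓ) : ∑ c : n,
        (if (i : ℕ) = (k : ℕ) + 1 then (1 : R) else 0) * (1 : Matrix n n R) a c * G k c b =
        if (i : ℕ) = (k : ℕ) + 1 then G k a b else 0 := by
      simp [Matrix.one_apply]
    simp only [hcol]
    split_ifs with hi
    · exact Finset.sum_eq_zero fun k _ => if_neg (by omega)
    · rw [Finset.sum_eq_single ⟨i - 1, by omega⟩]
      · exact if_pos (by simp only; omega)
      · exact fun k _ hk => if_neg fun h => hk (Fin.ext (by simp only; omega))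
      · simp
  rw [Fintype.sum_prod_type, Matrix.sub_apply, ← hdiag, ← hsub, ← Finset.sum_sub_distrib]
  refine Finset.sum_congr rfl fun k _ => ?_
  rw [← Finset.sum_sub_distrib]
  refine Finset.sum_congr rfl fun c _ => ?_
  simp only [Matrix.add_apply, Matrix.kroneckerMap_apply, Matrix.of_apply, Matrix.neg_apply]
  ring

/-- The inverse of `I_ℓ ⊗ A + S ⊗ (-I)` is block lower triangular Toeplitz, with blocks the
powers of `A⁻¹`. -/
lemma blockBidiagonal_mul_inverse {n R : Type*} [Fintype n] [DecidableEq n] [CommRing R] {ℓ : ℕ}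
    (A : Matrix n n R) (hA : IsUnit A.det) :
    ((1 : Matrix (Fin ℓ) (Fin ℓ) R) ⊗ₖ A +
        (Matrix.of fun i j : Fin ℓ => if (i : ℕ) = (j : ℕ) + 1 then (1 : R) else 0) ⊗ₖ
          (-(1 : Matrix n n R))) *
      (Matrix.of fun p q : Fin ℓ × n =>
        (if (q.1 : ℕ) ≤ p.1 then A⁻¹ ^ ((p.1 : ℕ) - q.1 + 1) else 0 : Matrix n n R) p.2 q.2) =
      1 := by
  ext ⟨i, a⟩ ⟨j, b⟩
  rw [Matrix.mul_apply]
  refine (blockBidiagonal_mul_apply A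
    (fun k => if (j : ℕ) ≤ k then A⁻¹ ^ (k - (j : ℕ) + 1) else 0) i a b).trans ?_
  have hcancel (k : ℕ) : A * A⁻¹ ^ (k + 1) = A⁻¹ ^ k := by
    rw [pow_succ', ← mul_assoc, Matrix.mul_nonsing_inv A hA, one_mul]
  have hblock : (A * (if (j : ℕ) ≤ i then A⁻¹ ^ ((i : ℕ) - j + 1) else 0) -
      if (i : ℕ) = 0 then 0 else
        if (j : ℕ) ≤ i - 1 then A⁻¹ ^ ((i : ℕ) - 1 - j + 1) else 0) =
      if i = j then 1 else 0 := by
    rcases lt_trichotomy i j with h | rfl | h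
    · have h' : (i : ℕ) < j := h
      rw [if_neg (by omega), if_neg (show ¬ (j : ℕ) ≤ i - 1 by omega), if_neg h.ne]
      simp
    · rw [if_pos le_rfl, hcancel]
      by_cases hi : (i : ℕ) = 0
      · simp [hi]
      · rw [if_neg (show ¬ (i : ℕ) ≤ i - 1 by omega)]
        simp
    · have h' : (j : ℕ) < i := h
      rw [if_pos h'.le, hcancel, if_neg (by omega), if_pos (by omega), if_neg h.ne',
        show (i : ℕ) - 1 - j + 1 = i - j by omega, sub_self]
  rw [hblock]
  by_cases h : i = j <;> simp [h, Matrix.one_apply]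

/-- With `𝒜 = I_ℓ ⊗ A + S ⊗ (-I_N)` the block lower bidiagonal matrix built
from a symmetric positive definite `A`, the matrix `𝒜` is invertible and its bottom-left
`N × N` block satisfies `E_ℓᵀ 𝒜⁻¹ E_1 = A⁻ℓ`. -/
theorem stmt1 {N : ℕ} (A : Matrix (Fin N) (Fin N) ℝ) (hA : A.PosDef)
    (ℓ : ℕ) (hℓ : 2 ≤ ℓ)
    (S : Matrix (Fin ℓ) (Fin ℓ) ℝ)
    (hS : S = Matrix.of fun i j : Fin ℓ => if (i : ℕ) = (j : ℕ) + 1 then (1 : ℝ) else 0)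
    (𝒜 : Matrix (Fin ℓ × Fin N) (Fin ℓ × Fin N) ℝ)
    (h𝒜 : 𝒜 = (1 : Matrix (Fin ℓ) (Fin ℓ) ℝ) ⊗ₖ A + S ⊗ₖ (-(1 : Matrix (Fin N) (Fin N) ℝ)))
    (E : Fin ℓ → Matrix (Fin ℓ × Fin N) (Fin N) ℝ)
    (hE : E = fun i => Matrix.of fun p k =>
      if p.1 = i ∧ p.2 = k then (1 : ℝ) else 0) :
    IsUnit 𝒜 ∧
      (E ⟨ℓ - 1, by omega⟩)ᵀ * 𝒜⁻¹ * E ⟨0, by omega⟩ = (A⁻¹) ^ ℓ := by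
  have hmul := blockBidiagonal_mul_inverse (ℓ := ℓ) A hA.det_pos.ne'.isUnit
  rw [← hS, ← h𝒜] at hmul
  refine ⟨IsUnit.of_mul_eq_one _ hmul, ?_⟩
  rw [Matrix.inv_eq_right_inv hmul]
  ext a b
  subst hE
  simp only [Matrix.mul_apply, Matrix.transpose_apply, Matrix.of_apply]
  rw [Fintype.sum_eq_single (⟨0, by omega⟩, b) (fun q hq => by
      rw [if_neg fun h => hq (Prod.ext h.1 h.2), mul_zero]),
    Fintype.sum_eq_single (⟨ℓ - 1, by omega⟩, a) (fun q hq => by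
      rw [if_neg fun h => hq (Prod.ext h.1 h.2), zero_mul])]
  simp [show ℓ - 1 + 1 = ℓ by omega]
end

section
/- Let A be an N×N real symmetric positive definite matrix with eigenvalues μ_1 ≥ … ≥ μ_N > 0, let ℓ ≥ 2 be an integer, and let α > 0 satisfy α ≠ μ_j^ℓ for all j. Let 𝒜 = I_ℓ ⊗ A + S ⊗ (−I_N) with S the ℓ×ℓ subdiagonal shift matrix, and let 𝒫_α = I_ℓ ⊗ A + C_α ⊗ (−I_N), where C_α is the ℓ×ℓ α-circulant matrix with ones on the subdiagonal, α in the (1,ℓ) entry, and zeros elsewhere. Then 𝒫_α is invertible and 𝒫_α^{−1} = 𝒜^{−1} + 𝒜^{−1} E_1 Z_α^{−1} E_ℓ^T 𝒜^{−1}, where Z_α = α^{-1}(I_N − α·A^{−ℓ}) and E_i = e_i ⊗ I_N. -/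
open Matrix Kronecker

/-- The inverse of the block bidiagonal matrix `I ⊗ A - S ⊗ I`, where `B` is the inverse of `A`. -/
def blockBidiagonalInv {N : ℕ} (ℓ : ℕ) (B : Matrix (Fin N) (Fin N) ℝ) :
    Matrix (Fin ℓ × Fin N) (Fin ℓ × Fin N) ℝ :=
  Matrix.of fun p q =>
    if (q.1 : ℕ) ≤ (p.1 : ℕ) then (B ^ ((p.1 : ℕ) - (q.1 : ℕ) + 1)) p.2 q.2 else 0

lemma kronecker_add_kronecker_neg_one_mul_apply {m n κ : Type*} [Fintype m] [DecidableEq m]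
    [Fintype n] [DecidableEq n] (A : Matrix n n ℝ) (T : Matrix m m ℝ)
    (M : Matrix (m × n) κ ℝ) (i : m) (a : n) (k : κ) :
    (((1 : Matrix m m ℝ) ⊗ₖ A + T ⊗ₖ (-(1 : Matrix n n ℝ))) * M) (i, a) k =
      ∑ b, A a b * M (i, b) k - ∑ j, T i j * M (j, a) k := by
  rw [Matrix.add_mul, Matrix.add_apply, sub_eq_add_neg, ← Finset.sum_neg_distrib]
  simp only [Matrix.mul_apply, kroneckerMap_apply, Fintype.sum_prod_type, Matrix.neg_apply,
    Matrix.one_apply]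
  congr 1
  · rw [Finset.sum_eq_single i]
    · simp
    · intro j _ hj
      simp [hj.symm]
    · simp
  · refine Finset.sum_congr rfl fun j _ => ?_
    simp

lemma mul_blockBidiagonalInv {N ℓ : ℕ} {A B : Matrix (Fin N) (Fin N) ℝ} (hAB : A * B = 1) :
    ((1 : Matrix (Fin ℓ) (Fin ℓ) ℝ) ⊗ₖ A +
      (Matrix.of fun i j : Fin ℓ => if (i : ℕ) = (j : ℕ) + 1 then (1 : ℝ) else 0) ⊗ₖ
        (-(1 : Matrix (Fin N) (Fin N) ℝ))) * blockBidiagonalInv ℓ B = 1 := by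
  have hpow : ∀ (n : ℕ) (a c : Fin N), ∑ b, A a b * (B ^ (n + 1)) b c = (B ^ n) a c := by
    intro n a c
    rw [← Matrix.mul_apply, pow_succ', ← Matrix.mul_assoc, hAB, Matrix.one_mul]
  ext ⟨i, a⟩ ⟨k, c⟩
  rw [kronecker_add_kronecker_neg_one_mul_apply]
  simp only [blockBidiagonalInv, Matrix.of_apply]
  have hfirst : ∑ b, A a b *
      (if (k : ℕ) ≤ (i : ℕ) then (B ^ ((i : ℕ) - (k : ℕ) + 1)) b c else 0) =
      if (k : ℕ) ≤ (i : ℕ) then (B ^ ((i : ℕ) - (k : ℕ))) a c else 0 := by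
    split_ifs with h
    · exact hpow _ _ _
    · simp
  have hsecond : ∑ j : Fin ℓ, (if (i : ℕ) = (j : ℕ) + 1 then (1 : ℝ) else 0) *
      (if (k : ℕ) ≤ (j : ℕ) then (B ^ ((j : ℕ) - (k : ℕ) + 1)) a c else 0) =
      if (k : ℕ) < (i : ℕ) then (B ^ ((i : ℕ) - (k : ℕ))) a c else 0 := by
    by_cases hi : (i : ℕ) = 0
    · rw [if_neg (by omega)]
      refine Finset.sum_eq_zero fun j _ => ?_
      rw [if_neg (by omega), zero_mul]
    · rw [Finset.sum_eq_single (⟨(i : ℕ) - 1, by omega⟩ : Fin ℓ)]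
      · rw [if_pos (by simp only; omega), one_mul]
        by_cases hk : (k : ℕ) < (i : ℕ)
        · rw [if_pos hk, if_pos (by simp only; omega)]
          rw [show (i : ℕ) - 1 - (k : ℕ) + 1 = (i : ℕ) - (k : ℕ) by omega]
        · rw [if_neg hk, if_neg (by simp only; omega)]
      · intro j _ hj
        rw [if_neg, zero_mul]
        intro h
        exact hj (Fin.ext (by simp only; omega))
      · simp
  rw [hfirst, hsecond]
  rcases lt_trichotomy (k : ℕ) (i : ℕ) with h | h | h
  · have hne : i ≠ k := fun e => by simp [e] at h
    simp [h, h.le, hne]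
  · obtain rfl : k = i := Fin.ext h
    simp [Matrix.one_apply]
  · have hne : i ≠ k := fun e => by simp [e] at h
    simp [h.not_ge, h.not_gt, hne]

lemma Matrix.IsHermitian.isUnit_pow_sub_smul_one {n : Type*} [Fintype n] [DecidableEq n]
    {A : Matrix n n ℝ} (hA : A.IsHermitian) (k : ℕ) {α : ℝ}
    (hne : ∀ j, α ≠ hA.eigenvalues j ^ k) : IsUnit (A ^ k - α • (1 : Matrix n n ℝ)) := by
  have hsa : IsSelfAdjoint A := hA
  have hmem : α ∉ spectrum ℝ (A ^ k) := by
    rw [← cfc_pow_id (R := ℝ) A k, cfc_map_spectrum (R := ℝ) (· ^ k) A,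
      hA.spectrum_real_eq_range_eigenvalues]
    rintro ⟨_, ⟨j, rfl⟩, hj⟩
    exact hne j hj.symm
  rw [spectrum.notMem_iff, Algebra.algebraMap_eq_smul_one] at hmem
  simpa using hmem.neg

lemma isUnit_add_mul_mul {m n : Type*} [Fintype m] [DecidableEq m] [Fintype n] [DecidableEq n]
    {A : Matrix n n ℝ} {U : Matrix n m ℝ} {C : Matrix m m ℝ} {V : Matrix m n ℝ}
    (hA : IsUnit A) (hC : IsUnit C) (hAC : IsUnit (C⁻¹ + V * A⁻¹ * U)) :
    IsUnit (A + U * C * V) := by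
  obtain ⟨_⟩ := hA.nonempty_invertible
  obtain ⟨_⟩ := hC.nonempty_invertible
  obtain ⟨iAC⟩ := hAC.nonempty_invertible
  simp only [← invOf_eq_nonsing_inv] at iAC
  let := invertibleAddMulMul A U C V
  exact isUnit_of_invertible _

/-- (Lemma on the Sherman–Morrison–Woodbury form of `P_α⁻¹`.)
With `𝒜 = I_ℓ ⊗ A + S ⊗ (-I_N)` and the block `α`-circulant `P_α = I_ℓ ⊗ A + C_α ⊗ (-I_N)`,
if `α > 0` avoids the values `μ_j^ℓ` (with `μ_j` the eigenvalues of the SPD matrix `A`), then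
`P_α` is invertible and `P_α⁻¹ = 𝒜⁻¹ + 𝒜⁻¹ E_1 Z_α⁻¹ E_ℓᵀ 𝒜⁻¹`,
where `Z_α = α⁻¹ (I_N - α A⁻ℓ)`. -/
theorem stmt2 {N : ℕ} (A : Matrix (Fin N) (Fin N) ℝ) (hA : A.PosDef)
    (ℓ : ℕ) (hℓ : 2 ≤ ℓ) (α : ℝ) (hα : 0 < α)
    (hne : ∀ j : Fin N, α ≠ (hA.1.eigenvalues j) ^ ℓ)
    (S : Matrix (Fin ℓ) (Fin ℓ) ℝ)
    (hS : S = Matrix.of fun i j : Fin ℓ => if (i : ℕ) = (j : ℕ) + 1 then (1 : ℝ) else 0)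
    (Cα : Matrix (Fin ℓ) (Fin ℓ) ℝ)
    (hC : Cα = Matrix.of fun i j : Fin ℓ =>
      if (i : ℕ) = (j : ℕ) + 1 then (1 : ℝ)
      else if (i : ℕ) = 0 ∧ (j : ℕ) = ℓ - 1 then α else 0)
    (𝒜 : Matrix (Fin ℓ × Fin N) (Fin ℓ × Fin N) ℝ)
    (h𝒜 : 𝒜 = (1 : Matrix (Fin ℓ) (Fin ℓ) ℝ) ⊗ₖ A + S ⊗ₖ (-(1 : Matrix (Fin N) (Fin N) ℝ)))
    (P : Matrix (Fin ℓ × Fin N) (Fin ℓ × Fin N) ℝ)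
    (hP : P = (1 : Matrix (Fin ℓ) (Fin ℓ) ℝ) ⊗ₖ A + Cα ⊗ₖ (-(1 : Matrix (Fin N) (Fin N) ℝ)))
    (Zα : Matrix (Fin N) (Fin N) ℝ)
    (hZ : Zα = α⁻¹ • ((1 : Matrix (Fin N) (Fin N) ℝ) - α • (A⁻¹) ^ ℓ))
    (E : Fin ℓ → Matrix (Fin ℓ × Fin N) (Fin N) ℝ)
    (hE : E = fun i => Matrix.of fun p k =>
      if p.1 = i ∧ p.2 = k then (1 : ℝ) else 0) :
    IsUnit P ∧
      P⁻¹ = 𝒜⁻¹ + 𝒜⁻¹ * E ⟨0, by omega⟩ * Zα⁻¹ * (E ⟨ℓ - 1, by omega⟩)ᵀ * 𝒜⁻¹ := by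
  have hAA : A * A⁻¹ = 1 := Matrix.mul_nonsing_inv A ((isUnit_iff_isUnit_det A).1 hA.isUnit)
  have hmul : 𝒜 * blockBidiagonalInv ℓ A⁻¹ = 1 := by
    rw [h𝒜, hS]
    exact mul_blockBidiagonalInv hAA
  have hinv : 𝒜⁻¹ = blockBidiagonalInv ℓ A⁻¹ := Matrix.inv_eq_right_inv hmul
  have h𝒜u : IsUnit 𝒜 := IsUnit.of_mul_eq_one _ hmul
  set U := E ⟨0, by omega⟩ with hU
  set V := E ⟨ℓ - 1, by omega⟩ with hV
  have hcorner : Vᵀ * 𝒜⁻¹ * U = A⁻¹ ^ ℓ := by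
    rw [hinv, hU, hV, hE]
    ext a b
    have hsub : ℓ - 1 + 1 = ℓ := by omega
    simp only [Matrix.mul_apply, Matrix.transpose_apply, Matrix.of_apply, blockBidiagonalInv,
      Fintype.sum_prod_type, ite_and]
    rw [Finset.sum_eq_single ⟨0, by omega⟩ (fun x _ hx => by simp [hx]) (by simp)]
    simp only [ite_mul, mul_ite, one_mul, zero_mul, mul_one, mul_zero, if_true,
      Finset.sum_ite_eq', Finset.mem_univ]
    rw [Finset.sum_eq_single ⟨ℓ - 1, by omega⟩ (fun x _ hx => by simp [hx]) (by simp)]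
    simp [hsub]
  have hCinv : ((-α) • (1 : Matrix (Fin N) (Fin N) ℝ))⁻¹ = (-α⁻¹) • 1 := by
    apply Matrix.inv_eq_right_inv
    simp [hα.ne']
  have hCu : IsUnit ((-α) • (1 : Matrix (Fin N) (Fin N) ℝ)) :=
    IsUnit.of_mul_eq_one ((-α⁻¹) • 1) (by simp [hα.ne'])
  have hcap : ((-α) • (1 : Matrix (Fin N) (Fin N) ℝ))⁻¹ + Vᵀ * 𝒜⁻¹ * U = -Zα := by
    rw [hCinv, hcorner, hZ, smul_sub, smul_smul, inv_mul_cancel₀ hα.ne', one_smul, neg_smul]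
    abel
  have hZu : IsUnit Zα := by
    have hpow : A⁻¹ ^ ℓ * A ^ ℓ = 1 := by
      rw [Matrix.inv_pow']
      exact Matrix.nonsing_inv_mul _ ((isUnit_iff_isUnit_det _).1 (hA.isUnit.pow ℓ))
    have hfac : Zα = (α⁻¹ • 1) * (A⁻¹ ^ ℓ * (A ^ ℓ - α • (1 : Matrix (Fin N) (Fin N) ℝ))) := by
      rw [hZ, Matrix.mul_sub, hpow]
      simp
    rw [hfac]
    exact (IsUnit.of_mul_eq_one (α • 1) (by simp [hα.ne'])).mul
      ((IsUnit.of_mul_eq_one _ hpow).mul (hA.1.isUnit_pow_sub_smul_one ℓ hne))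
  have hPeq : P = 𝒜 + U * ((-α) • (1 : Matrix (Fin N) (Fin N) ℝ)) * Vᵀ := by
    have hentry : ∀ p q, (U * Vᵀ) p q =
        if (p.1 : ℕ) = 0 ∧ (q.1 : ℕ) = ℓ - 1 ∧ p.2 = q.2 then 1 else 0 := by
      rintro ⟨i, a⟩ ⟨j, b⟩
      simp only [hU, hV, hE, Matrix.mul_apply, Matrix.transpose_apply, Matrix.of_apply, Fin.ext_iff]
      by_cases hi : (i : ℕ) = 0 <;> by_cases hj : (j : ℕ) = ℓ - 1 <;>
        simp [hi, hj, ← Fin.ext_iff]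
    rw [hP, h𝒜, hC, hS, Matrix.mul_smul, Matrix.mul_one, Matrix.smul_mul, add_assoc]
    congr 1
    ext ⟨i, a⟩ ⟨j, b⟩
    simp only [Matrix.add_apply, Matrix.smul_apply, hentry, kroneckerMap_apply, Matrix.of_apply,
      Matrix.neg_apply, Matrix.one_apply, smul_eq_mul]
    by_cases hij : (i : ℕ) = (j : ℕ) + 1
    · have hi : (i : ℕ) ≠ 0 := by omega
      simp [hij]
    · by_cases hab : a = b <;> by_cases hi : (i : ℕ) = 0 <;> by_cases hj : (j : ℕ) = ℓ - 1 <;>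
        simp [hij, hab, hi, hj]
  have hcapu : IsUnit (((-α) • (1 : Matrix (Fin N) (Fin N) ℝ))⁻¹ + Vᵀ * 𝒜⁻¹ * U) :=
    hcap ▸ hZu.neg
  refine ⟨hPeq ▸ isUnit_add_mul_mul h𝒜u hCu hcapu, ?_⟩
  have hZneg : (-Zα)⁻¹ = -Zα⁻¹ := by
    apply Matrix.inv_eq_right_inv
    rw [neg_mul_neg, Matrix.mul_nonsing_inv _ ((isUnit_iff_isUnit_det _).1 hZu)]
  rw [hPeq, Matrix.add_mul_mul_inv_eq_sub _ _ _ _ h𝒜u hCu hcapu, hcap, hZneg]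
  simp only [Matrix.mul_neg, Matrix.neg_mul, sub_neg_eq_add]
end

section
/- Let A be an N×N real symmetric positive definite matrix with eigenvalues μ_1 ≥ … ≥ μ_N > 0 (counted with multiplicity), let ℓ ≥ 2 be an integer, and let α > 0 satisfy α ≠ μ_j^ℓ for all j. With 𝒜 = I_ℓ ⊗ A + S ⊗ (−I_N) and 𝒫_α = I_ℓ ⊗ A + C_α ⊗ (−I_N), the characteristic polynomial of 𝒫_α^{−1}𝒜 equals (X − 1)^{(ℓ−1)N} · ∏_{j=1}^{N} (X − μ_j^ℓ/(μ_j^ℓ − α)); in particular, the eigenvalues of 𝒫_α^{−1}𝒜 are 1 with multiplicity (ℓ−1)N together with μ_j^ℓ/(μ_j^ℓ − α) for j = 1,…,N. -/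
open Matrix Kronecker Polynomial

/-- The characteristic determinant of a weighted cyclic shift with subdiagonal `b` and
top-right corner `c`. -/
theorem det_smul_one_sub_weightedShift {R : Type*} [CommRing R] {n : ℕ} (hn : n ≠ 0)
    (x b c : R) (Z : Matrix (Fin (n + 1)) (Fin (n + 1)) R)
    (hZ : ∀ i j, Z i j = if (i : ℕ) = (j : ℕ) + 1 then b
      else if (i : ℕ) = 0 ∧ (j : ℕ) = n then c else 0) :
    (x • (1 : Matrix (Fin (n + 1)) (Fin (n + 1)) R) - Z).det = x ^ (n + 1) - b ^ n * c := by
  set M := x • (1 : Matrix (Fin (n + 1)) (Fin (n + 1)) R) - Z with hM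
  have entry : ∀ i j, M i j = (if i = j then x else 0) - Z i j := by
    intro i j
    simp [hM, Matrix.one_apply]
  have h_first : (M.submatrix Fin.succ (Fin.succAbove 0)).det = x ^ n := by
    rw [Matrix.det_of_isLowerTriangular]
    · simp [entry, hZ]
    · intro i j hij
      have hij : i < j := hij
      have h1 : (i : ℕ) < j := hij
      have h2 : ¬ ((i : ℕ) = (j : ℕ) + 1) := by omega
      simp [entry, hZ, hij.ne, h2]
  have h_last : (M.submatrix Fin.succ (Fin.last n).succAbove).det = (-b) ^ n := by
    rw [Matrix.det_of_isUpperTriangular]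
    · have h2 : ∀ i : Fin n, i.succ ≠ i.castSucc := fun i => (Fin.castSucc_lt_succ).ne'
      simp [entry, hZ, h2]
    · intro i j hij
      have h1 : (j : ℕ) < i := hij
      have h2 : i.succ ≠ j.castSucc := by
        intro h
        have := congrArg Fin.val h
        simp at this
        omega
      have h3 : (i : ℕ) ≠ j := by omega
      simp [entry, hZ, h2, h3]
  have h_ne : (0 : Fin (n + 1)) ≠ Fin.last n := by
    intro h
    exact hn (congrArg Fin.val h).symm
  rw [Matrix.det_succ_row_zero, Finset.sum_eq_add (0 : Fin (n + 1)) (Fin.last n) h_ne]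
  · rw [h_first, h_last]
    have e0 : M 0 0 = x := by simp [entry, hZ, hn.symm]
    have e1 : M 0 (Fin.last n) = -c := by simp [entry, hZ, h_ne]
    rw [e0, e1, neg_pow b, Fin.val_last]
    have := Even.neg_one_pow (α := R) (Even.add_self n)
    rw [pow_add] at this
    simp only [Fin.val_zero, pow_zero, one_mul]
    linear_combination (-c * b ^ n) * this
  · rintro j - ⟨hj0, hjn⟩
    have h2 : (j : ℕ) ≠ n := fun h => hjn (Fin.ext h)
    simp [entry, hZ, hj0.symm, h2]
  · simp
  · simp

/-- The determinant of `I ⊗ aA - Z ⊗ I` factors over the eigenvalues of `A`. -/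
theorem det_one_kronecker_add_kronecker_neg_one {m n : Type*} [Fintype m] [DecidableEq m]
    [Fintype n] [DecidableEq n] {A : Matrix n n ℝ} (hA : A.IsHermitian) (a : ℝ)
    (Z : Matrix m m ℝ) :
    ((1 : Matrix m m ℝ) ⊗ₖ (a • A) + Z ⊗ₖ (-(1 : Matrix n n ℝ))).det =
      ∏ j, ((a * hA.eigenvalues j) • (1 : Matrix m m ℝ) - Z).det := by
  set U : Matrix n n ℝ := hA.eigenvectorUnitary.1
  have hUU : U * star U = 1 := Unitary.coe_mul_star_self hA.eigenvectorUnitary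
  have hspec : A = U * diagonal hA.eigenvalues * star U := by
    have := hA.spectral_theorem
    simpa [Unitary.conjStarAlgAut_apply, Function.comp_def] using this
  have hblock : (1 : Matrix m m ℝ) ⊗ₖ (a • diagonal hA.eigenvalues) +
      Z ⊗ₖ (-(1 : Matrix n n ℝ)) =
      blockDiagonal fun j => (a * hA.eigenvalues j) • (1 : Matrix m m ℝ) - Z := by
    ext ⟨i, k⟩ ⟨i', k'⟩
    by_cases hk : k = k'
    · subst hk
      simp [blockDiagonal_apply, kroneckerMap_apply]
      ring
    · simp [blockDiagonal_apply, kroneckerMap_apply, hk]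
  have hconj : (1 : Matrix m m ℝ) ⊗ₖ (a • A) + Z ⊗ₖ (-(1 : Matrix n n ℝ)) =
      ((1 : Matrix m m ℝ) ⊗ₖ U) * ((1 : Matrix m m ℝ) ⊗ₖ (a • diagonal hA.eigenvalues) +
        Z ⊗ₖ (-(1 : Matrix n n ℝ))) * ((1 : Matrix m m ℝ) ⊗ₖ star U) := by
    rw [mul_add, add_mul, ← mul_kronecker_mul, ← mul_kronecker_mul, ← mul_kronecker_mul,
      ← mul_kronecker_mul]
    simp only [one_mul, mul_one, mul_neg, neg_mul, hUU, mul_smul_comm, smul_mul_assoc]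
    rw [← hspec]
  have hdet : ((1 : Matrix m m ℝ) ⊗ₖ U).det * ((1 : Matrix m m ℝ) ⊗ₖ star U).det = 1 := by
    rw [← det_mul, ← mul_kronecker_mul, hUU, one_mul, one_kronecker_one, det_one]
  rw [hconj, det_mul, det_mul, hblock, det_blockDiagonal]
  linear_combination
    (∏ j, ((a * hA.eigenvalues j) • (1 : Matrix m m ℝ) - Z).det) * hdet

/-- The characteristic polynomial of the preconditioned matrix `𝒫_α⁻¹ 𝒜`
equals `(X - 1)^((ℓ-1)N) ∏_j (X - μ_j^ℓ/(μ_j^ℓ - α))`, so its eigenvalues are `1` with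
multiplicity `(ℓ-1)N` together with `μ_j^ℓ/(μ_j^ℓ - α)` for `j = 1, …, N`. -/
theorem stmt3 {N : ℕ} (A : Matrix (Fin N) (Fin N) ℝ) (hA : A.PosDef)
    (ℓ : ℕ) (hℓ : 2 ≤ ℓ) (α : ℝ) (hα : 0 < α)
    (hne : ∀ j : Fin N, α ≠ (hA.1.eigenvalues j) ^ ℓ)
    (S : Matrix (Fin ℓ) (Fin ℓ) ℝ)
    (hS : S = Matrix.of fun i j : Fin ℓ => if (i : ℕ) = (j : ℕ) + 1 then (1 : ℝ) else 0)
    (Cα : Matrix (Fin ℓ) (Fin ℓ) ℝ)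
    (hC : Cα = Matrix.of fun i j : Fin ℓ =>
      if (i : ℕ) = (j : ℕ) + 1 then (1 : ℝ)
      else if (i : ℕ) = 0 ∧ (j : ℕ) = ℓ - 1 then α else 0)
    (𝒜 : Matrix (Fin ℓ × Fin N) (Fin ℓ × Fin N) ℝ)
    (h𝒜 : 𝒜 = (1 : Matrix (Fin ℓ) (Fin ℓ) ℝ) ⊗ₖ A + S ⊗ₖ (-(1 : Matrix (Fin N) (Fin N) ℝ)))
    (P : Matrix (Fin ℓ × Fin N) (Fin ℓ × Fin N) ℝ)
    (hP : P = (1 : Matrix (Fin ℓ) (Fin ℓ) ℝ) ⊗ₖ A + Cα ⊗ₖ (-(1 : Matrix (Fin N) (Fin N) ℝ))) :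
    (P⁻¹ * 𝒜).charpoly =
      (X - 1) ^ ((ℓ - 1) * N) *
        ∏ j : Fin N,
          (X - C ((hA.1.eigenvalues j) ^ ℓ / ((hA.1.eigenvalues j) ^ ℓ - α))) := by
  obtain ⟨n, rfl⟩ : ∃ n, ℓ = n + 1 := ⟨ℓ - 1, by omega⟩
  have hn : n ≠ 0 := by omega
  set μ := hA.1.eigenvalues
  have hdetP : P.det = ∏ j, (μ j ^ (n + 1) - α) := by
    have h := det_one_kronecker_add_kronecker_neg_one hA.1 1 Cα
    rw [one_smul, ← hP] at h
    rw [h]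
    refine Finset.prod_congr rfl fun j _ => ?_
    rw [det_smul_one_sub_weightedShift hn (1 * μ j) 1 α Cα (by simp [hC])]
    ring
  have hsub : ∀ j, μ j ^ (n + 1) - α ≠ 0 := fun j => sub_ne_zero.mpr (hne j).symm
  have hP0 : P.det ≠ 0 := by
    rw [hdetP]
    exact Finset.prod_ne_zero_iff.mpr fun j _ => hsub j
  have hpencil : ∀ t : ℝ, (t • P - 𝒜).det =
      ∏ j, ((t - 1) ^ n * (t * (μ j ^ (n + 1) - α) - μ j ^ (n + 1))) := by
    intro t
    have hsplit : t • P - 𝒜 = (1 : Matrix (Fin (n + 1)) (Fin (n + 1)) ℝ) ⊗ₖ ((t - 1) • A) +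
        (t • Cα - S) ⊗ₖ (-(1 : Matrix (Fin N) (Fin N) ℝ)) := by
      ext ⟨i, k⟩ ⟨i', k'⟩
      simp [hP, h𝒜, kroneckerMap_apply]
      ring
    rw [hsplit, det_one_kronecker_add_kronecker_neg_one hA.1]
    refine Finset.prod_congr rfl fun j _ => ?_
    rw [det_smul_one_sub_weightedShift hn ((t - 1) * μ j) (t - 1) (t * α)]
    · rw [mul_pow]
      ring
    · intro i i'
      simp only [hC, hS, Matrix.sub_apply, Matrix.smul_apply, of_apply, smul_eq_mul, add_tsub_cancel_right]
      split_ifs <;> ring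
  refine Polynomial.funext fun t => ?_
  have hfactor : scalar _ t - P⁻¹ * 𝒜 = P⁻¹ * (t • P - 𝒜) := by
    rw [mul_sub, mul_smul_comm, nonsing_inv_mul _ (isUnit_iff_ne_zero.mpr hP0),
      scalar_apply, smul_one_eq_diagonal]
  rw [eval_charpoly, hfactor, det_mul, det_nonsing_inv, Ring.inverse_eq_inv', hpencil, hdetP]
  simp only [eval_mul, eval_pow, eval_sub, eval_X, eval_one, eval_prod, eval_C,
    add_tsub_cancel_right]
  rw [Finset.prod_mul_distrib, Finset.prod_const, Finset.card_univ, Fintype.card_fin, ← pow_mul,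
    mul_left_comm, ← Finset.prod_inv_distrib, ← Finset.prod_mul_distrib]
  congr 1
  refine Finset.prod_congr rfl fun j _ => ?_
  have := hsub j
  field_simp
end

section
/- Let A be an N×N real symmetric positive definite matrix with eigenvalues μ_1 ≥ … ≥ μ_N > 0, let ℓ ≥ 2 be an integer, and let α > 0 satisfy α ≠ μ_j^ℓ for all j. With 𝒜 = I_ℓ ⊗ A + S ⊗ (−I_N) and 𝒫_α = I_ℓ ⊗ A + C_α ⊗ (−I_N), the matrix 𝒫_α^{−1}𝒜 is diagonalizable over ℝ: there exist an invertible real ℓN×ℓN matrix Q̂ and a diagonal real ℓN×ℓN matrix D such that 𝒫_α^{−1}𝒜 = Q̂ D Q̂^{−1}. -/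
open Matrix Kronecker

/-- The lower shift matrix with `a` in its top-right entry. -/
def cornerShift (n : ℕ) (a : ℝ) : Matrix (Fin n) (Fin n) ℝ :=
  Matrix.of fun i j => if (i : ℕ) = (j : ℕ) + 1 then (1 : ℝ)
    else if (i : ℕ) = 0 ∧ (j : ℕ) = n - 1 then a else 0

/-- The identity matrix with its last column replaced by `(μ ^ (n - 1 - i))ᵢ`. -/
def lastColPow (n : ℕ) (μ : ℝ) : Matrix (Fin n) (Fin n) ℝ :=
  Matrix.of fun i k => if (k : ℕ) = n - 1 then μ ^ (n - 1 - (i : ℕ)) else if i = k then 1 else 0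

/-- The diagonal of the identity matrix with its last entry replaced by `c`. -/
def lastEntry (n : ℕ) (c : ℝ) (k : Fin n) : ℝ := if (k : ℕ) = n - 1 then c else 1

lemma isUnit_lastColPow (n : ℕ) (μ : ℝ) : IsUnit (lastColPow n μ) := by
  rw [Matrix.isUnit_iff_isUnit_det, Matrix.det_of_isUpperTriangular]
  · refine isUnit_iff_ne_zero.2 (Finset.prod_ne_zero_iff.2 fun i _ => ?_)
    simp +contextual [lastColPow]
  · intro i k hik
    have hki : (k : ℕ) < i := hik
    have h1 : (k : ℕ) ≠ n - 1 := by omega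
    have h2 : i ≠ k := fun h => by simp [h] at hki
    simp [lastColPow, h1, h2]

lemma isUnit_smul_one_sub_cornerShift (n : ℕ) {μ : ℝ} (hμ : μ ≠ 0) :
    IsUnit (μ • (1 : Matrix (Fin n) (Fin n) ℝ) - cornerShift n 0) := by
  rw [Matrix.isUnit_iff_isUnit_det, Matrix.det_of_isLowerTriangular]
  · refine isUnit_iff_ne_zero.2 (Finset.prod_ne_zero_iff.2 fun i _ => ?_)
    simp [cornerShift, hμ]
  · intro i k hik
    have hik' : (i : ℕ) < k := hik
    have h1 : (i : ℕ) ≠ k + 1 := by omega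
    have h2 : i ≠ k := fun h => by simp [h] at hik'
    simp [cornerShift, h1, h2]

lemma cornerShift_mul_zero {n : ℕ} (a : ℝ) (M : Matrix (Fin (n + 1)) (Fin (n + 1)) ℝ)
    (k : Fin (n + 1)) : (cornerShift (n + 1) a * M) 0 k = a * M (Fin.last n) k := by
  rw [Matrix.mul_apply, Finset.sum_eq_single (Fin.last n)]
  · simp [cornerShift]
  · intro j _ hj
    have : (j : ℕ) ≠ n := fun h => hj (Fin.ext h)
    simp [cornerShift, this]
  · simp

lemma cornerShift_mul_succ {n : ℕ} (a : ℝ) (M : Matrix (Fin (n + 1)) (Fin (n + 1)) ℝ)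
    (i : Fin n) (k : Fin (n + 1)) :
    (cornerShift (n + 1) a * M) i.succ k = M i.castSucc k := by
  rw [Matrix.mul_apply, Finset.sum_eq_single i.castSucc]
  · simp [cornerShift]
  · intro j _ hj
    have : (i : ℕ) ≠ j := fun h => hj (Fin.ext h.symm)
    simp [cornerShift, this]
  · simp

lemma shift_mul_lastColPow (n : ℕ) (hn : 2 ≤ n) {μ α : ℝ} (hne : α ≠ μ ^ n) :
    (μ • (1 : Matrix (Fin n) (Fin n) ℝ) - cornerShift n 0) * lastColPow n μ =
      (μ • (1 : Matrix (Fin n) (Fin n) ℝ) - cornerShift n α) * lastColPow n μ *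
        Matrix.diagonal (lastEntry n (μ ^ n / (μ ^ n - α))) := by
  obtain ⟨n, rfl⟩ : ∃ m, n = m + 1 := ⟨n - 1, by omega⟩
  have hd : μ ^ (n + 1) - α ≠ 0 := sub_ne_zero.2 hne.symm
  ext i k
  rw [Matrix.mul_diagonal, Matrix.sub_mul, Matrix.sub_mul, Matrix.sub_apply, Matrix.sub_apply,
    Matrix.smul_mul, Matrix.one_mul, Matrix.smul_apply, smul_eq_mul]
  by_cases hk : (k : ℕ) = n
  · cases i using Fin.cases with
    | zero =>
      rw [cornerShift_mul_zero, cornerShift_mul_zero]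
      simp [lastColPow, lastEntry, hk]
      field_simp
      ring
    | succ i =>
      rw [cornerShift_mul_succ, cornerShift_mul_succ]
      have : n - (i : ℕ) = n - (i + 1) + 1 := by omega
      simp [lastColPow, lastEntry, hk, this, pow_succ]
      ring_nf
  · have hk' : Fin.last n ≠ k := fun h => hk (by simp [← h])
    cases i using Fin.cases with
    | zero =>
      rw [cornerShift_mul_zero, cornerShift_mul_zero]
      simp [lastColPow, lastEntry, hk, hk']
    | succ i =>
      rw [cornerShift_mul_succ, cornerShift_mul_succ]
      simp [lastEntry, hk]

/-- `1 ⊗ U` block-diagonalizes `1 ⊗ A - C ⊗ 1` when `U` diagonalizes `A`. -/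
lemma kronecker_sub_mul_one_kronecker {m n : Type*} [Fintype m] [DecidableEq m] [Fintype n]
    [DecidableEq n] {A U : Matrix n n ℝ} {d : n → ℝ} (h : A * U = U * Matrix.diagonal d)
    (C : Matrix m m ℝ) :
    ((1 : Matrix m m ℝ) ⊗ₖ A + C ⊗ₖ (-(1 : Matrix n n ℝ))) * ((1 : Matrix m m ℝ) ⊗ₖ U) =
      ((1 : Matrix m m ℝ) ⊗ₖ U) *
        Matrix.blockDiagonal fun j => d j • (1 : Matrix m m ℝ) - C := by
  have hB : (Matrix.blockDiagonal fun j => d j • (1 : Matrix m m ℝ) - C) =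
      (1 : Matrix m m ℝ) ⊗ₖ Matrix.diagonal d + C ⊗ₖ (-(1 : Matrix n n ℝ)) := by
    ext ⟨i, j⟩ ⟨k, l⟩
    by_cases hjl : j = l <;>
      simp [Matrix.blockDiagonal_apply, Matrix.kroneckerMap_apply, hjl, mul_comm, sub_eq_add_neg]
  rw [hB, add_mul, mul_add]
  simp only [← Matrix.mul_kronecker_mul, h, Matrix.one_mul, Matrix.mul_one, Matrix.neg_mul,
    Matrix.mul_neg]

lemma isUnit_blockDiagonal {m n : Type*} [Fintype m] [DecidableEq m] [Fintype n]
    [DecidableEq n] {M : n → Matrix m m ℝ} (h : ∀ j, IsUnit (M j)) :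
    IsUnit (Matrix.blockDiagonal M) := by
  rw [Matrix.isUnit_iff_isUnit_det, Matrix.det_blockDiagonal, isUnit_iff_ne_zero]
  exact Finset.prod_ne_zero_iff.2 fun j _ => ((Matrix.isUnit_iff_isUnit_det _).1 (h j)).ne_zero

/-- Under the hypotheses of the paper (SPD `A`, `α > 0`, `α ≠ μ_j^ℓ`),
the preconditioned matrix `𝒫_α⁻¹ 𝒜` is diagonalizable over `ℝ`: there are an invertible real
matrix `Q̂` and a diagonal real matrix `D` with `𝒫_α⁻¹ 𝒜 = Q̂ D Q̂⁻¹`. -/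
theorem stmt4 {N : ℕ} (A : Matrix (Fin N) (Fin N) ℝ) (hA : A.PosDef)
    (ℓ : ℕ) (hℓ : 2 ≤ ℓ) (α : ℝ) (hα : 0 < α)
    (hne : ∀ j : Fin N, α ≠ (hA.1.eigenvalues j) ^ ℓ)
    (S : Matrix (Fin ℓ) (Fin ℓ) ℝ)
    (hS : S = Matrix.of fun i j : Fin ℓ => if (i : ℕ) = (j : ℕ) + 1 then (1 : ℝ) else 0)
    (Cα : Matrix (Fin ℓ) (Fin ℓ) ℝ)
    (hC : Cα = Matrix.of fun i j : Fin ℓ =>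
      if (i : ℕ) = (j : ℕ) + 1 then (1 : ℝ)
      else if (i : ℕ) = 0 ∧ (j : ℕ) = ℓ - 1 then α else 0)
    (𝒜 : Matrix (Fin ℓ × Fin N) (Fin ℓ × Fin N) ℝ)
    (h𝒜 : 𝒜 = (1 : Matrix (Fin ℓ) (Fin ℓ) ℝ) ⊗ₖ A + S ⊗ₖ (-(1 : Matrix (Fin N) (Fin N) ℝ)))
    (P : Matrix (Fin ℓ × Fin N) (Fin ℓ × Fin N) ℝ)
    (hP : P = (1 : Matrix (Fin ℓ) (Fin ℓ) ℝ) ⊗ₖ A + Cα ⊗ₖ (-(1 : Matrix (Fin N) (Fin N) ℝ))) :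
    ∃ (Q D : Matrix (Fin ℓ × Fin N) (Fin ℓ × Fin N) ℝ),
      IsUnit Q ∧ D.IsDiag ∧ P⁻¹ * 𝒜 = Q * D * Q⁻¹ := by
  have hS' : S = cornerShift ℓ 0 := by
    rw [hS]; ext i j; simp [cornerShift]
  have hC' : Cα = cornerShift ℓ α := hC
  rw [hS'] at h𝒜
  rw [hC'] at hP
  set μ := hA.1.eigenvalues with hμ
  let U : Matrix (Fin N) (Fin N) ℝ := hA.1.eigenvectorUnitary
  have hU : IsUnit U := (Unitary.toUnits hA.1.eigenvectorUnitary).isUnit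
  have hAU : A * U = U * Matrix.diagonal μ := by
    ext i j
    have := congrFun (hA.1.mulVec_eigenvectorBasis j) i
    rw [Matrix.mul_diagonal]
    simpa [U, Matrix.mul_apply, Matrix.mulVec, dotProduct, mul_comm] using this
  let W : Matrix (Fin ℓ × Fin N) (Fin ℓ × Fin N) ℝ := (1 : Matrix (Fin ℓ) (Fin ℓ) ℝ) ⊗ₖ U
  let V := Matrix.blockDiagonal fun j => lastColPow ℓ (μ j)
  let D := Matrix.blockDiagonal fun j =>
    Matrix.diagonal (lastEntry ℓ (μ j ^ ℓ / (μ j ^ ℓ - α)))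
  let BS := Matrix.blockDiagonal fun j => μ j • (1 : Matrix (Fin ℓ) (Fin ℓ) ℝ) - cornerShift ℓ 0
  let BC := Matrix.blockDiagonal fun j => μ j • (1 : Matrix (Fin ℓ) (Fin ℓ) ℝ) - cornerShift ℓ α
  have hSW : 𝒜 * W = W * BS := h𝒜 ▸ kronecker_sub_mul_one_kronecker hAU _
  have hCW : P * W = W * BC := hP ▸ kronecker_sub_mul_one_kronecker hAU _
  have hVD : BS * V = BC * V * D := by
    simp only [BS, BC, V, D, ← Matrix.blockDiagonal_mul]
    exact congrArg _ (funext fun j => shift_mul_lastColPow ℓ hℓ (hne j))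
  have hV : IsUnit V := isUnit_blockDiagonal fun j => isUnit_lastColPow ℓ _
  have hBS : IsUnit BS := isUnit_blockDiagonal fun j =>
    isUnit_smul_one_sub_cornerShift ℓ (hA.eigenvalues_pos j).ne'
  have hW : IsUnit W := by
    rw [Matrix.isUnit_iff_isUnit_det] at hU ⊢
    simpa [W, Matrix.det_kronecker] using hU.pow _
  have hQ : IsUnit (W * V) := hW.mul hV
  have hmain : 𝒜 * (W * V) = P * (W * V * D) := by
    rw [← mul_assoc, hSW, mul_assoc, hVD]
    simp only [← mul_assoc, hCW]
  have hPu : IsUnit P.det := by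
    have h : IsUnit (𝒜 * (W * V)).det := by
      rw [← Matrix.isUnit_iff_isUnit_det, ← mul_assoc, hSW]
      exact (hW.mul hBS).mul hV
    rw [hmain, Matrix.det_mul] at h
    exact isUnit_of_mul_isUnit_left h
  refine ⟨W * V, D, hQ, ?_, ?_⟩
  · rintro ⟨i, j⟩ ⟨k, l⟩ h
    by_cases hjl : j = l
    · subst hjl
      have hik : i ≠ k := fun hik => h (by rw [hik])
      simp [D, hik]
    · simp [D, hjl]
  · have hQd := (Matrix.isUnit_iff_isUnit_det _).1 hQ
    calc P⁻¹ * 𝒜 = P⁻¹ * (𝒜 * (W * V)) * (W * V)⁻¹ := by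
          rw [mul_assoc, Matrix.mul_nonsing_inv_cancel_right _ _ hQd]
      _ = W * V * D * (W * V)⁻¹ := by
          rw [hmain, Matrix.nonsing_inv_mul_cancel_left _ _ hPu]
end

section
/- Let A be an N×N real symmetric positive definite matrix with eigenvalues μ_1 ≥ … ≥ μ_N > 0, let ℓ ≥ 2 be an integer, and suppose 0 < α < μ_N^ℓ. With 𝒜 = I_ℓ ⊗ A + S ⊗ (−I_N) and 𝒫_α = I_ℓ ⊗ A + C_α ⊗ (−I_N), every eigenvalue λ of 𝒫_α^{−1}𝒜 satisfies 1 ≤ λ ≤ μ_N^ℓ/(μ_N^ℓ − α); moreover 1 is an eigenvalue (so the smallest eigenvalue equals 1) and μ_N^ℓ/(μ_N^ℓ − α) is an eigenvalue (so the largest eigenvalue equals μ_N^ℓ/(μ_N^ℓ − α)). -/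
open Matrix Kronecker

/-- The `ℓ × ℓ` matrix with ones on the subdiagonal and `c` in the top-right entry. -/
def alphaCirculant (ℓ : ℕ) (c : ℝ) : Matrix (Fin ℓ) (Fin ℓ) ℝ :=
  Matrix.of fun i j : Fin ℓ =>
    if (i : ℕ) = (j : ℕ) + 1 then (1 : ℝ)
    else if (i : ℕ) = 0 ∧ (j : ℕ) = ℓ - 1 then c else 0

/-- The all-at-once matrix `I ⊗ A - C_c ⊗ I`. -/
def allAtOnce {N : ℕ} (A : Matrix (Fin N) (Fin N) ℝ) (ℓ : ℕ) (c : ℝ) :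
    Matrix (Fin ℓ × Fin N) (Fin ℓ × Fin N) ℝ :=
  (1 : Matrix (Fin ℓ) (Fin ℓ) ℝ) ⊗ₖ A + alphaCirculant ℓ c ⊗ₖ (-(1 : Matrix (Fin N) (Fin N) ℝ))

theorem mem_spectrum_iff_exists_mulVec {n : Type*} [Fintype n] [DecidableEq n]
    (B : Matrix n n ℝ) (c : ℝ) :
    c ∈ spectrum ℝ B ↔ ∃ v, v ≠ 0 ∧ B *ᵥ v = c • v := by
  rw [spectrum.mem_iff, Matrix.isUnit_iff_isUnit_det, isUnit_iff_ne_zero, not_not,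
    ← Matrix.exists_mulVec_eq_zero_iff]
  simp only [Matrix.sub_mulVec, Algebra.algebraMap_eq_smul_one, Matrix.smul_mulVec, Matrix.one_mulVec,
    sub_eq_zero, eq_comm]

theorem spectrum_pow_of_isHermitian {n : Type*} [Fintype n] [DecidableEq n]
    {B : Matrix n n ℝ} (hB : B.IsHermitian) (k : ℕ) :
    spectrum ℝ (B ^ k) = (fun x => x ^ k) '' spectrum ℝ B := by
  have h : IsSelfAdjoint B := hB
  rw [← cfc_pow_id (R := ℝ) B k, cfc_map_spectrum (R := ℝ) (fun x => x ^ k) B]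

theorem allAtOnce_mulVec_zero {N : ℕ} (A : Matrix (Fin N) (Fin N) ℝ) (m : ℕ) (c : ℝ)
    (x : Fin (m + 1) × Fin N → ℝ) (k : Fin N) :
    (allAtOnce A (m + 1) c *ᵥ x) (0, k) =
      (A *ᵥ fun k => x (0, k)) k - c * x (Fin.last m, k) := by
  simp only [allAtOnce, alphaCirculant, Matrix.add_mulVec, Pi.add_apply]
  simp only [Matrix.mulVec, dotProduct, Fintype.sum_prod_type, Matrix.kroneckerMap_apply,
    Matrix.of_apply, Matrix.neg_apply]
  have h (j : Fin (m + 1)) : (j : ℕ) = m ↔ j = Fin.last m := by simp [Fin.ext_iff]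
  simp [Matrix.one_apply, ite_mul, Finset.sum_ite_irrel, h, sub_eq_add_neg]

theorem allAtOnce_mulVec_succ {N : ℕ} (A : Matrix (Fin N) (Fin N) ℝ) (m : ℕ) (c : ℝ)
    (x : Fin (m + 1) × Fin N → ℝ) (i : Fin m) (k : Fin N) :
    (allAtOnce A (m + 1) c *ᵥ x) (i.succ, k) =
      (A *ᵥ fun k => x (i.succ, k)) k - x (i.castSucc, k) := by
  simp only [allAtOnce, alphaCirculant, Matrix.add_mulVec, Pi.add_apply]
  simp only [Matrix.mulVec, dotProduct, Fintype.sum_prod_type, Matrix.kroneckerMap_apply,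
    Matrix.of_apply, Matrix.neg_apply]
  have h (j : Fin (m + 1)) : (i : ℕ) = j ↔ i.castSucc = j := by simp [Fin.ext_iff]
  simp [Matrix.one_apply, ite_mul, Finset.sum_ite_irrel, h, sub_eq_add_neg]

theorem det_allAtOnce_eq_zero_iff {N : ℕ} (A : Matrix (Fin N) (Fin N) ℝ) (m : ℕ) (c : ℝ) :
    (allAtOnce A (m + 1) c).det = 0 ↔ c ∈ spectrum ℝ (A ^ (m + 1)) := by
  rw [← Matrix.exists_mulVec_eq_zero_iff, mem_spectrum_iff_exists_mulVec]
  constructor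
  · rintro ⟨x, hx, h⟩
    have h0 : (A *ᵥ fun k => x (0, k)) = c • fun k => x (Fin.last m, k) := by
      funext k
      have := congrFun h (0, k)
      rw [allAtOnce_mulVec_zero, Pi.zero_apply, sub_eq_zero] at this
      simpa using this
    have hs (i : Fin m) : (A *ᵥ fun k => x (i.succ, k)) = fun k => x (i.castSucc, k) := by
      funext k
      have := congrFun h (i.succ, k)
      rwa [allAtOnce_mulVec_succ, Pi.zero_apply, sub_eq_zero] at this
    have key (i : Fin (m + 1)) :
        (fun k => x (i, k)) = A ^ (m - i) *ᵥ fun k => x (Fin.last m, k) := by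
      induction i using Fin.reverseInduction with
      | last => simp
      | cast i ih =>
        rw [← hs, ih, Matrix.mulVec_mulVec, ← pow_succ']
        congr 2
        simp only [Fin.val_succ, Fin.val_castSucc]
        omega
    refine ⟨fun k => x (Fin.last m, k), fun h => hx ?_, ?_⟩
    · funext ⟨i, k⟩
      have := congrFun (key i) k
      rwa [h, Matrix.mulVec_zero] at this
    · rw [← h0, key 0, Matrix.mulVec_mulVec, ← pow_succ']
      rfl
  · rintro ⟨v, hv, h⟩
    refine ⟨fun p => (A ^ (m - p.1) *ᵥ v) p.2, fun h => hv ?_, ?_⟩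
    · funext k
      simpa using congrFun h (Fin.last m, k)
    · funext ⟨i, k⟩
      induction i using Fin.cases with
      | zero =>
        rw [allAtOnce_mulVec_zero]
        change (A *ᵥ (A ^ m *ᵥ v)) k - _ = 0
        rw [Matrix.mulVec_mulVec, ← pow_succ', h]
        simp
      | succ i =>
        rw [allAtOnce_mulVec_succ]
        change (A *ᵥ (A ^ (m - (i + 1)) *ᵥ v)) k - (A ^ (m - i) *ᵥ v) k = 0
        rw [Matrix.mulVec_mulVec, ← pow_succ', show m - (i + 1) + 1 = m - i by omega, sub_self]

theorem smul_allAtOnce_sub {N : ℕ} (A : Matrix (Fin N) (Fin N) ℝ) (ℓ : ℕ) {lam a c : ℝ}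
    (h : lam * a = (lam - 1) * c) :
    lam • allAtOnce A ℓ a - allAtOnce A ℓ 0 = (lam - 1) • allAtOnce A ℓ c := by
  ext ⟨i, k⟩ ⟨j, l⟩
  simp only [allAtOnce, alphaCirculant, Matrix.sub_apply, Matrix.smul_apply, Matrix.add_apply,
    Matrix.kroneckerMap_apply, Matrix.of_apply, smul_eq_mul]
  split_ifs
  · ring
  · linear_combination (-1 : Matrix (Fin N) (Fin N) ℝ) k l * h
  · ring

theorem det_allAtOnce_sub {N : ℕ} (hN : 0 < N) (A : Matrix (Fin N) (Fin N) ℝ) (m : ℕ)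
    (a b : ℝ) :
    (allAtOnce A (m + 2) a - allAtOnce A (m + 2) b).det = 0 := by
  refine Matrix.det_eq_zero_of_column_eq_zero (0, ⟨0, hN⟩) fun ⟨i, k⟩ => ?_
  simp [allAtOnce, alphaCirculant]

theorem mem_spectrum_inv_mul_iff {n : Type*} [Fintype n] [DecidableEq n]
    {P B : Matrix n n ℝ} (hP : P.det ≠ 0) (lam : ℝ) :
    lam ∈ spectrum ℝ (P⁻¹ * B) ↔ (lam • P - B).det = 0 := by
  have h : lam • P - B = P * (algebraMap ℝ _ lam - P⁻¹ * B) := by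
    rw [mul_sub, Matrix.mul_nonsing_inv_cancel_left _ _ (isUnit_iff_ne_zero.mpr hP),
      Algebra.algebraMap_eq_smul_one, mul_smul_comm, mul_one]
  rw [spectrum.mem_iff, Matrix.isUnit_iff_isUnit_det, isUnit_iff_ne_zero, not_not, h,
    Matrix.det_mul, mul_eq_zero, or_iff_right hP]


/-- If `0 < α < μ_N^ℓ`, where `μ_N` is the smallest eigenvalue of the SPD
matrix `A`, then every eigenvalue `λ` of `𝒫_α⁻¹ 𝒜` satisfies `1 ≤ λ ≤ μ_N^ℓ/(μ_N^ℓ - α)`,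
and both endpoints `1` and `μ_N^ℓ/(μ_N^ℓ - α)` are attained as eigenvalues. -/
theorem stmt5 {N : ℕ} (A : Matrix (Fin N) (Fin N) ℝ) (hA : A.PosDef)
    (ℓ : ℕ) (hℓ : 2 ≤ ℓ) (α : ℝ)
    (μN : ℝ) (hμN_mem : μN ∈ spectrum ℝ A) (hμN_min : ∀ x ∈ spectrum ℝ A, μN ≤ x)
    (hα : 0 < α) (hαμ : α < μN ^ ℓ)
    (S : Matrix (Fin ℓ) (Fin ℓ) ℝ)
    (hS : S = Matrix.of fun i j : Fin ℓ => if (i : ℕ) = (j : ℕ) + 1 then (1 : ℝ) else 0)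
    (Cα : Matrix (Fin ℓ) (Fin ℓ) ℝ)
    (hC : Cα = Matrix.of fun i j : Fin ℓ =>
      if (i : ℕ) = (j : ℕ) + 1 then (1 : ℝ)
      else if (i : ℕ) = 0 ∧ (j : ℕ) = ℓ - 1 then α else 0)
    (𝒜 : Matrix (Fin ℓ × Fin N) (Fin ℓ × Fin N) ℝ)
    (h𝒜 : 𝒜 = (1 : Matrix (Fin ℓ) (Fin ℓ) ℝ) ⊗ₖ A + S ⊗ₖ (-(1 : Matrix (Fin N) (Fin N) ℝ)))
    (P : Matrix (Fin ℓ × Fin N) (Fin ℓ × Fin N) ℝ)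
    (hP : P = (1 : Matrix (Fin ℓ) (Fin ℓ) ℝ) ⊗ₖ A + Cα ⊗ₖ (-(1 : Matrix (Fin N) (Fin N) ℝ))) :
    (∀ lam ∈ spectrum ℝ (P⁻¹ * 𝒜), 1 ≤ lam ∧ lam ≤ μN ^ ℓ / (μN ^ ℓ - α)) ∧
      (1 : ℝ) ∈ spectrum ℝ (P⁻¹ * 𝒜) ∧
      μN ^ ℓ / (μN ^ ℓ - α) ∈ spectrum ℝ (P⁻¹ * 𝒜) := by
  have hSC : S = alphaCirculant ℓ 0 := by
    rw [hS]
    ext i j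
    simp [alphaCirculant]
  have h𝒜' : 𝒜 = allAtOnce A ℓ 0 := by rw [h𝒜, hSC, allAtOnce]
  have hP' : P = allAtOnce A ℓ α := by rw [hP, hC, allAtOnce, alphaCirculant]
  clear h𝒜 hP hS hC hSC
  subst h𝒜' hP'
  obtain ⟨m, rfl⟩ : ∃ m, ℓ = m + 2 := ⟨ℓ - 2, by omega⟩
  have hN : 0 < N := by
    rcases Nat.eq_zero_or_pos N with rfl | h
    · obtain ⟨v, hv, -⟩ := (mem_spectrum_iff_exists_mulVec A μN).mp hμN_mem
      exact absurd (Subsingleton.elim v 0) hv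
    · exact h
  have hμN : 0 < μN := by
    rw [hA.isHermitian.spectrum_real_eq_range_eigenvalues] at hμN_mem
    obtain ⟨i, rfl⟩ := hμN_mem
    exact hA.eigenvalues_pos i
  have hpow := spectrum_pow_of_isHermitian hA.isHermitian (m + 2)
  have hmem : μN ^ (m + 2) ∈ spectrum ℝ (A ^ (m + 2)) := hpow ▸ ⟨μN, hμN_mem, rfl⟩
  have hmin : ∀ ν ∈ spectrum ℝ (A ^ (m + 2)), μN ^ (m + 2) ≤ ν := by
    rw [hpow]
    rintro _ ⟨x, hx, rfl⟩
    exact pow_le_pow_left₀ hμN.le (hμN_min x hx) _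
  have hdet : (allAtOnce A (m + 2) α).det ≠ 0 := fun h =>
    (hmin α ((det_allAtOnce_eq_zero_iff A (m + 1) α).mp h)).not_gt hαμ
  have hiff (lam ν : ℝ) (hlam : lam ≠ 1) (h : lam * α = (lam - 1) * ν) :
      lam ∈ spectrum ℝ ((allAtOnce A (m + 2) α)⁻¹ * allAtOnce A (m + 2) 0) ↔
        ν ∈ spectrum ℝ (A ^ (m + 2)) := by
    rw [mem_spectrum_inv_mul_iff hdet, smul_allAtOnce_sub A _ h, Matrix.det_smul, mul_eq_zero,
      or_iff_right (pow_ne_zero _ (sub_ne_zero.mpr hlam)), det_allAtOnce_eq_zero_iff]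
  generalize μN ^ (m + 2) = M at *
  have hM : 0 < M - α := sub_pos.mpr hαμ
  refine ⟨fun lam hlam => ?_, ?_, ?_⟩
  · rcases eq_or_ne lam 1 with rfl | hne
    · exact ⟨le_rfl, (one_le_div hM).mpr (by linarith)⟩
    · have hne' : lam - 1 ≠ 0 := sub_ne_zero.mpr hne
      obtain ⟨ν, hν⟩ : ∃ ν, lam * α = (lam - 1) * ν :=
        ⟨lam * α / (lam - 1), by field_simp⟩
      have hMν := hmin ν ((hiff lam ν hne hν).mp hlam)
      have hνα : 0 < ν - α := by linarith
      have hlam' : lam = ν / (ν - α) := by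
        rw [eq_div_iff hνα.ne']
        linarith
      rw [hlam']
      refine ⟨(one_le_div hνα).mpr (by linarith), ?_⟩
      rw [div_le_div_iff₀ hνα hM]
      nlinarith
  · rw [mem_spectrum_inv_mul_iff hdet, one_smul]
    exact det_allAtOnce_sub hN A m α 0
  · refine (hiff _ M ?_ ?_).mpr hmem
    · rw [Ne, div_eq_one_iff_eq hM.ne']
      linarith
    · field_simp
      ring
end

section
/- Let Φ and Ψ be N×N real symmetric positive definite matrices. Let 𝒮 be the 2N×2N block matrix with blocks [[Φ, Ψ], [Ψ, −Φ]] and let 𝒫_D be the 2N×2N block diagonal matrix with both diagonal blocks equal to Φ + Ψ. Then for every real number ζ and every nonzero vector u ∈ ℝ^{2N} with 𝒮u = ζ·𝒫_D u (i.e. every eigenvalue ζ of 𝒫_D^{−1}𝒮), one has 1/2 ≤ ζ² ≤ 1; equivalently, ζ ∈ [−1, −1/√2] ∪ [1/√2, 1]. -/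
open Matrix

theorem Matrix.IsHermitian.dotProduct_mulVec_comm_real {n : Type*} [Fintype n]
    {A : Matrix n n ℝ} (hA : A.IsHermitian) (x y : n → ℝ) :
    x ⬝ᵥ A *ᵥ y = y ⬝ᵥ A *ᵥ x := by
  have hT : Aᵀ = A := by simpa [Matrix.IsHermitian, conjTranspose] using hA
  rw [dotProduct_mulVec, ← mulVec_transpose, hT, dotProduct_comm]

theorem Matrix.PosDef.sq_dotProduct_mulVec_le {n : Type*} [Fintype n]
    {A : Matrix n n ℝ} (hA : A.PosDef) (x y : n → ℝ) :
    (x ⬝ᵥ A *ᵥ y) ^ 2 ≤ (x ⬝ᵥ A *ᵥ x) * (y ⬝ᵥ A *ᵥ y) := by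
  by_cases hy : y = 0
  · simp [hy]
  have hq : 0 < y ⬝ᵥ A *ᵥ y := by simpa using hA.dotProduct_mulVec_pos hy
  have h := hA.posSemidef.dotProduct_mulVec_nonneg
    ((y ⬝ᵥ A *ᵥ y) • x - (x ⬝ᵥ A *ᵥ y) • y)
  simp only [star_trivial, mulVec_sub, mulVec_smul, sub_dotProduct, dotProduct_sub,
    smul_dotProduct, dotProduct_smul, smul_eq_mul,
    hA.isHermitian.dotProduct_mulVec_comm_real y x] at h
  refine le_of_sub_nonneg (nonneg_of_mul_nonneg_right ?_ hq)
  linarith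

/-- For SPD matrices `Φ, Ψ`, every generalized eigenvalue `ζ` of the
saddle point matrix `𝒮 = [[Φ, Ψ], [Ψ, −Φ]]` with respect to the block diagonal
preconditioner `𝒫_D = diag(Φ+Ψ, Φ+Ψ)` satisfies `1/2 ≤ ζ² ≤ 1`, i.e.
`ζ ∈ [−1, −1/√2] ∪ [1/√2, 1]`. -/
theorem stmt16 {N : ℕ} (Φ Ψ : Matrix (Fin N) (Fin N) ℝ)
    (hΦ : Φ.PosDef) (hΨ : Ψ.PosDef)
    (𝒮 : Matrix (Fin N ⊕ Fin N) (Fin N ⊕ Fin N) ℝ)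
    (h𝒮 : 𝒮 = Matrix.fromBlocks Φ Ψ Ψ (-Φ))
    (PD : Matrix (Fin N ⊕ Fin N) (Fin N ⊕ Fin N) ℝ)
    (hPD : PD = Matrix.fromBlocks (Φ + Ψ) 0 0 (Φ + Ψ)) :
    ∀ (ζ : ℝ) (u : Fin N ⊕ Fin N → ℝ), u ≠ 0 →
      𝒮.mulVec u = ζ • PD.mulVec u →
      1 / 2 ≤ ζ ^ 2 ∧ ζ ^ 2 ≤ 1 := by
  intro ζ u hu h
  subst h𝒮 hPD
  obtain ⟨x, y, rfl⟩ : ∃ x y : Fin N → ℝ, u = Sum.elim x y :=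
    ⟨u ∘ Sum.inl, u ∘ Sum.inr, (Sum.elim_comp_inl_inr u).symm⟩
  have h₁ : Φ *ᵥ x + Ψ *ᵥ y = ζ • (Φ + Ψ) *ᵥ x := by
    ext i
    simpa [fromBlocks_mulVec] using congrFun h (Sum.inl i)
  have h₂ : Ψ *ᵥ x - Φ *ᵥ y = ζ • (Φ + Ψ) *ᵥ y := by
    ext i
    simpa [fromBlocks_mulVec, neg_mulVec, sub_eq_add_neg] using congrFun h (Sum.inr i)
  have hP := hΦ.add hΨ
  have hp : 0 ≤ x ⬝ᵥ (Φ + Ψ) *ᵥ x := by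
    simpa using hP.posSemidef.dotProduct_mulVec_nonneg x
  have hq : 0 ≤ y ⬝ᵥ (Φ + Ψ) *ᵥ y := by
    simpa using hP.posSemidef.dotProduct_mulVec_nonneg y
  have hpos : 0 < x ⬝ᵥ (Φ + Ψ) *ᵥ x + y ⬝ᵥ (Φ + Ψ) *ᵥ y := by
    by_cases hx : x = 0
    · have hy : y ≠ 0 := by
        rintro rfl
        exact hu (by rw [hx]; ext i; cases i <;> rfl)
      have : 0 < y ⬝ᵥ (Φ + Ψ) *ᵥ y := by simpa using hP.dotProduct_mulVec_pos hy
      linarith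
    · have : 0 < x ⬝ᵥ (Φ + Ψ) *ᵥ x := by simpa using hP.dotProduct_mulVec_pos hx
      linarith
  have hcs := hP.sq_dotProduct_mulVec_le x y
  have e₁ := congrArg (x ⬝ᵥ ·) h₁
  have e₂ := congrArg (y ⬝ᵥ ·) h₁
  have e₃ := congrArg (x ⬝ᵥ ·) h₂
  have e₄ := congrArg (y ⬝ᵥ ·) h₂
  have f₁ := hΦ.posSemidef.dotProduct_mulVec_nonneg x
  have f₂ := hΦ.posSemidef.dotProduct_mulVec_nonneg y
  have f₃ := hΨ.posSemidef.dotProduct_mulVec_nonneg (x - y)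
  have f₄ := hΨ.posSemidef.dotProduct_mulVec_nonneg (x + y)
  simp only [star_trivial, add_mulVec, mulVec_add, mulVec_sub, dotProduct_add, dotProduct_sub,
    add_dotProduct, sub_dotProduct, dotProduct_smul, smul_eq_mul,
    hΦ.isHermitian.dotProduct_mulVec_comm_real y x,
    hΨ.isHermitian.dotProduct_mulVec_comm_real y x]
    at hp hq hpos hcs e₁ e₂ e₃ e₄ f₁ f₂ f₃ f₄
  generalize x ⬝ᵥ Φ *ᵥ x = a at *
  generalize x ⬝ᵥ Φ *ᵥ y = b at *
  generalize y ⬝ᵥ Φ *ᵥ y = c at *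
  generalize x ⬝ᵥ Ψ *ᵥ x = d at *
  generalize x ⬝ᵥ Ψ *ᵥ y = e at *
  generalize y ⬝ᵥ Ψ *ᵥ y = f at *
  constructor
  · have key : a + d + (c + f) = ζ * ((a + d) - (c + f) + 2 * (b + e)) := by
      linear_combination e₁ + e₂ + e₃ - e₄
    have hT : ((a + d) - (c + f) + 2 * (b + e)) ^ 2 ≤ 2 * (a + d + (c + f)) ^ 2 := by
      linarith [sq_nonneg ((a + d) - (c + f) - 2 * (b + e))]
    have hsq : (a + d + (c + f)) ^ 2 ≤ 2 * ζ ^ 2 * (a + d + (c + f)) ^ 2 := by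
      calc (a + d + (c + f)) ^ 2
          = ζ ^ 2 * ((a + d) - (c + f) + 2 * (b + e)) ^ 2 := by rw [← mul_pow, ← key]
        _ ≤ ζ ^ 2 * (2 * (a + d + (c + f)) ^ 2) := by gcongr
        _ = 2 * ζ ^ 2 * (a + d + (c + f)) ^ 2 := by ring
    have : 1 ≤ 2 * ζ ^ 2 := by
      refine le_of_mul_le_mul_right ?_ (pow_pos hpos 2)
      linarith
    linarith
  · refine (sq_le_one_iff_abs_le_one ζ).2 (abs_le.2 ⟨?_, ?_⟩)
    · refine le_of_mul_le_mul_right ?_ hpos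
      linarith
    · refine le_of_mul_le_mul_right ?_ hpos
      linarith
end
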